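/- Let λ > 0 and 0 < t < λ. For U ∈ U(2), let Z_U be the 5×2 complex matrix whose first two rows form √(t/λ)·I₂, whose third row is zero, and whose last two rows form √((λ−t)/λ)·U. Then the set of 5×5 complex Hermitian matrices x with characteristic polynomial X³(X−λ)², leading principal 2×2 submatrix x^(2) = t·I₂, characteristic polynomial of x^(3) equal to X(X−t)², and characteristic polynomial of x^(4) equal to X²(X−t)(X−λ), equals { λ·Z_U·Z_Uᴴ : U ∈ U(2) }, and the map U ↦ λ·Z_U·Z_Uᴴ is injective (so this fiber is in bijection with, indeed diffeomorphic to, U(2)). -/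

import Mathlib

open Polynomial Matrix

/-- The `5×2` matrix `Z_U` whose first two rows form `√(t/λ)·I₂`, third row is zero, and
last two rows form `√((λ−t)/λ)·U`. -/
noncomputable def ZU (lam t : ℝ) (U : Matrix (Fin 2) (Fin 2) ℂ) :
    Matrix (Fin 5) (Fin 2) ℂ :=
  Matrix.of
    ![![(Real.sqrt (t / lam) : ℂ), 0],
      ![0, (Real.sqrt (t / lam) : ℂ)],
      ![0, 0],
      fun j => (Real.sqrt ((lam - t) / lam) : ℂ) * U 0 j,
      fun j => (Real.sqrt ((lam - t) / lam) : ℂ) * U 1 j]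

open scoped ComplexOrder in
/-- A Hermitian matrix annihilated by `X³(X - a)²`, with `a` real, satisfies `x² = a x`. -/
theorem Matrix.IsHermitian.sq_eq_smul_of_charpoly {n : Type*} [Fintype n] [DecidableEq n]
    {x : Matrix n n ℂ} (hx : x.IsHermitian) (a : ℝ)
    (hc : x.charpoly = X ^ 3 * (X - C (a : ℂ)) ^ 2) : x * x = (a : ℂ) • x := by
  have hCH := Matrix.aeval_self_charpoly x
  rw [hc] at hCH
  simp only [map_mul, map_pow, map_sub, aeval_X, aeval_C] at hCH
  set s : Matrix n n ℂ := algebraMap ℂ (Matrix n n ℂ) a with hs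
  have hcomm : Commute x s := (Algebra.commutes (a : ℂ) x).symm
  have hsH : sᴴ = s := by
    simp [hs, Algebra.algebraMap_eq_smul_one, Matrix.conjTranspose_smul]
  set y := x * (x - s) with hy
  have hxy : Commute x (x - s) := (Commute.refl x).sub_right hcomm
  have hyH : yᴴ = y := by
    rw [hy, Matrix.conjTranspose_mul, Matrix.conjTranspose_sub, hsH, hx.eq, hxy.eq]
  have hy3 : y ^ 3 = 0 := by
    rw [hy, hxy.mul_pow, pow_succ (x - s) 2, ← mul_assoc, hCH, zero_mul]
  have hy2 : y * y = 0 := by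
    rw [← Matrix.conjTranspose_mul_self_eq_zero, Matrix.conjTranspose_mul, hyH]
    calc y * y * (y * y) = y ^ 3 * y := by noncomm_ring
      _ = 0 := by rw [hy3, zero_mul]
  have hy0 : y = 0 := by
    rw [← Matrix.conjTranspose_mul_self_eq_zero, hyH, hy2]
  rw [hy, mul_sub, sub_eq_zero] at hy0
  rw [hy0, hs, Algebra.algebraMap_eq_smul_one, Matrix.mul_smul, mul_one]

theorem Matrix.charpoly_two_by_two (M : Matrix (Fin 2) (Fin 2) ℂ) :
    M.charpoly = X ^ 2 - C (M 0 0 + M 1 1) * X + C (M 0 0 * M 1 1 - M 0 1 * M 1 0) := by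
  simp [Matrix.charpoly, Matrix.det_fin_two]
  ring

/-- Principal submatrices of `s • Z Zᴴ` have, up to powers of `X`, the characteristic polynomial
of the Gram matrix of the corresponding rows of `Z`. -/
theorem charpoly_submatrix_smul_mul_conjTranspose {m n : ℕ} (hn : 2 ≤ n) (f : Fin n → Fin m)
    (s : ℂ) (Z : Matrix (Fin m) (Fin 2) ℂ) :
    ((s • (Z * Zᴴ)).submatrix f f).charpoly =
      X ^ (n - 2) * (s • ((Z.submatrix f id)ᴴ * Z.submatrix f id)).charpoly := by
  have h : (s • (Z * Zᴴ)).submatrix f f = (s • Z.submatrix f id) * (Z.submatrix f id)ᴴ := by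
    ext i j
    simp [Matrix.mul_apply]
    ring
  rw [h, Matrix.charpoly_mul_comm_of_le _ _ (by simpa using hn), Matrix.mul_smul]
  simp

theorem mul_sqrt_div_mul_self {a b : ℝ} (hb : 0 < b) (ha : 0 ≤ a) :
    (b : ℂ) * ((Real.sqrt (a / b) : ℂ) * (Real.sqrt (a / b) : ℂ)) = a := by
  rw [← Complex.ofReal_mul, Real.mul_self_sqrt (by positivity), ← Complex.ofReal_mul,
    mul_div_cancel₀ _ hb.ne']

theorem mul_sqrt_mul_sqrt {lam t : ℝ} (h0 : 0 < t) (h1 : t < lam) :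
    (lam : ℂ) * ((Real.sqrt (t / lam) : ℂ) * (Real.sqrt ((lam - t) / lam) : ℂ)) =
      (Real.sqrt (t * (lam - t)) : ℂ) := by
  have hl : 0 < lam := h0.trans h1
  norm_cast
  rw [← Real.sqrt_mul (by positivity), div_mul_div_comm, Real.sqrt_div (by nlinarith),
    Real.sqrt_mul_self hl.le]
  field_simp

/-- The entries of `λ Z_U Z_Uᴴ`. -/
theorem smul_ZU_mul_conjTranspose {lam t : ℝ} (h0 : 0 < t) (h1 : t < lam)
    {U : Matrix (Fin 2) (Fin 2) ℂ} (hU : U ∈ Matrix.unitaryGroup (Fin 2) ℂ) :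
    (lam : ℂ) • (ZU lam t U * (ZU lam t U)ᴴ) =
      !![(t : ℂ), 0, 0, Real.sqrt (t * (lam - t)) * star (U 0 0),
          Real.sqrt (t * (lam - t)) * star (U 1 0);
        0, t, 0, Real.sqrt (t * (lam - t)) * star (U 0 1),
          Real.sqrt (t * (lam - t)) * star (U 1 1);
        0, 0, 0, 0, 0;
        Real.sqrt (t * (lam - t)) * U 0 0, Real.sqrt (t * (lam - t)) * U 0 1, 0, lam - t, 0;
        Real.sqrt (t * (lam - t)) * U 1 0, Real.sqrt (t * (lam - t)) * U 1 1, 0, 0, lam - t] := by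
  have hl : 0 < lam := h0.trans h1
  have haa := mul_sqrt_div_mul_self hl h0.le
  have hbb := mul_sqrt_div_mul_self hl (sub_pos.2 h1).le
  rw [Complex.ofReal_sub] at hbb
  rw [← mul_sqrt_mul_sqrt h0 h1]
  have hUU := Matrix.mem_unitaryGroup_iff.1 hU
  have e00 := congr_fun₂ hUU 0 0
  have e01 := congr_fun₂ hUU 0 1
  have e10 := congr_fun₂ hUU 1 0
  have e11 := congr_fun₂ hUU 1 1
  simp [Matrix.mul_apply, Matrix.star_apply] at e00 e01 e10 e11
  generalize hra : Real.sqrt (t / lam) = a at *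
  generalize hrb : Real.sqrt ((lam - t) / lam) = b at *
  ext i j
  fin_cases i <;> fin_cases j <;>
    simp only [Matrix.smul_apply, Matrix.mul_apply, Matrix.conjTranspose_apply,
      Fin.sum_univ_two] <;>
    simp [ZU, hra, hrb] <;> clear hra hrb <;> grind

open scoped ComplexOrder in
/-- A Hermitian matrix with `x² = λ x` whose leading `3×3` block has diagonal `t, t, 0` and
vanishing `(0, 1)` entry is of the form `λ Z_U Z_Uᴴ`. -/
theorem exists_eq_smul_ZU_mul_conjTranspose {lam t : ℝ} (h0 : 0 < t) (h1 : t < lam)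
    {x : Matrix (Fin 5) (Fin 5) ℂ}
    (hx : x.IsHermitian) (hsq : x * x = (lam : ℂ) • x)
    (h00 : x 0 0 = t) (h01 : x 0 1 = 0) (h11 : x 1 1 = t) (h22 : x 2 2 = 0) :
    ∃ U ∈ Matrix.unitaryGroup (Fin 2) ℂ, x = (lam : ℂ) • (ZU lam t U * (ZU lam t U)ᴴ) := by
  have hH : ∀ i j, star (x j i) = x i j := fun i j => congr_fun₂ hx i j
  have hS : ∀ i j, ∑ k, x i k * x k j = lam * x i j := fun i j => by
    simpa [Matrix.mul_apply] using congr_fun₂ hsq i j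
  have h2 : ∀ k, x 2 k = 0 := by
    have h := hS 2 2
    rw [h22, mul_zero] at h
    have h' : x 2 ⬝ᵥ star (x 2) = 0 := by
      simpa only [dotProduct, Pi.star_apply, hH] using h
    exact congr_fun (dotProduct_self_star_eq_zero.1 h')
  have h2' : ∀ k, x k 2 = 0 := fun k => by rw [← hH, h2, star_zero]
  have h10 : x 1 0 = 0 := by rw [← hH, h01, star_zero]
  have hc : 0 < t * (lam - t) := mul_pos h0 (sub_pos.2 h1)
  have hcc : (Real.sqrt (t * (lam - t)) : ℂ) * Real.sqrt (t * (lam - t)) = t * (lam - t) := by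
    rw [← Complex.ofReal_mul, Real.mul_self_sqrt hc.le]
    push_cast
    ring
  have hc0 : (Real.sqrt (t * (lam - t)) : ℂ) ≠ 0 :=
    Complex.ofReal_ne_zero.2 (Real.sqrt_pos.2 hc).ne'
  generalize hrc : Real.sqrt (t * (lam - t)) = c at *
  have s00 := hS 0 0
  have s01 := hS 0 1
  have s10 := hS 1 0
  have s11 := hS 1 1
  have s30 := hS 3 0
  have s31 := hS 3 1
  have s40 := hS 4 0
  have s41 := hS 4 1
  simp only [Fin.sum_univ_five, h00, h01, h10, h11, h2, h2', mul_zero, zero_mul, add_zero,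
    zero_add] at s00 s01 s10 s11 s30 s31 s40 s41
  let U : Matrix (Fin 2) (Fin 2) ℂ := !![x 3 0 / c, x 3 1 / c; x 4 0 / c, x 4 1 / c]
  have hUU : star U * U = 1 := by
    ext i j
    fin_cases i <;> fin_cases j <;>
      simp [U, Matrix.mul_apply, Matrix.star_apply] <;> simp only [← Complex.star_def, hH] <;>
      field_simp <;> grind
  have hU : U ∈ Matrix.unitaryGroup (Fin 2) ℂ := Matrix.mem_unitaryGroup_iff'.2 hUU
  have hD : !![x 3 3, x 3 4; x 4 3, x 4 4] = ((lam : ℂ) - t) • (1 : Matrix (Fin 2) (Fin 2) ℂ) := by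
    have hDU : !![x 3 3, x 3 4; x 4 3, x 4 4] * U = (((lam : ℂ) - t) • 1) * U := by
      ext i j
      fin_cases i <;> fin_cases j <;> simp [U, Matrix.mul_apply] <;> field_simp <;> grind
    have h := congr_arg (· * star U) hDU
    simpa [mul_assoc, Matrix.mem_unitaryGroup_iff.1 hU] using h
  have d33 := congr_fun₂ hD 0 0
  have d34 := congr_fun₂ hD 0 1
  have d43 := congr_fun₂ hD 1 0
  have d44 := congr_fun₂ hD 1 1
  simp at d33 d34 d43 d44
  refine ⟨U, hU, ?_⟩
  rw [smul_ZU_mul_conjTranspose h0 h1 hU, hrc]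
  ext i j
  fin_cases i <;> fin_cases j <;>
    simp [U, h00, h01, h10, h11, h2, h2', d33, d34, d43, d44, ← hH 0 3, ← hH 0 4, ← hH 1 3,
      ← hH 1 4] <;> field_simp

/-- The spectra of `λ Z_U Z_Uᴴ` and of its leading principal submatrices. -/
theorem charpoly_smul_ZU_mul_conjTranspose {lam t : ℝ} (h0 : 0 < t) (h1 : t < lam)
    {U : Matrix (Fin 2) (Fin 2) ℂ} (hU : U ∈ Matrix.unitaryGroup (Fin 2) ℂ) :
    ((lam : ℂ) • (ZU lam t U * (ZU lam t U)ᴴ)).charpoly = X ^ 3 * (X - C (lam : ℂ)) ^ 2 ∧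
    (((lam : ℂ) • (ZU lam t U * (ZU lam t U)ᴴ)).submatrix
      (Fin.castLE (by norm_num : 3 ≤ 5)) (Fin.castLE (by norm_num))).charpoly =
        X * (X - C (t : ℂ)) ^ 2 ∧
    (((lam : ℂ) • (ZU lam t U * (ZU lam t U)ᴴ)).submatrix
      (Fin.castLE (by norm_num : 4 ≤ 5)) (Fin.castLE (by norm_num))).charpoly =
        X ^ 2 * (X - C (t : ℂ)) * (X - C (lam : ℂ)) := by
  have hl : 0 < lam := h0.trans h1
  have haa := mul_sqrt_div_mul_self hl h0.le
  have hbb := mul_sqrt_div_mul_self hl (sub_pos.2 h1).le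
  rw [Complex.ofReal_sub] at hbb
  have hUU := Matrix.mem_unitaryGroup_iff'.1 hU
  have e00 := congr_fun₂ hUU 0 0
  have e01 := congr_fun₂ hUU 0 1
  have e10 := congr_fun₂ hUU 1 0
  have e11 := congr_fun₂ hUU 1 1
  have f00 := congr_fun₂ (Matrix.mem_unitaryGroup_iff.1 hU) 0 0
  simp [Matrix.mul_apply, Matrix.star_apply] at e00 e01 e10 e11 f00
  refine ⟨?_, ?_, ?_⟩
  · have h := charpoly_submatrix_smul_mul_conjTranspose (by norm_num : 2 ≤ 5) id (lam : ℂ)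
      (ZU lam t U)
    rw [Matrix.submatrix_id_id, Matrix.submatrix_id_id] at h
    have hG : (lam : ℂ) • ((ZU lam t U)ᴴ * ZU lam t U) = (lam : ℂ) • 1 := by
      ext i j
      fin_cases i <;> fin_cases j <;>
        simp only [Matrix.smul_apply, Matrix.mul_apply, Matrix.conjTranspose_apply,
          Fin.sum_univ_five] <;>
        simp [ZU] <;> grind
    rw [h, hG, Matrix.charpoly_two_by_two]
    simp
    ring
  · rw [charpoly_submatrix_smul_mul_conjTranspose (by norm_num), Matrix.charpoly_two_by_two]
    simp only [Matrix.smul_apply, Matrix.mul_apply, Matrix.conjTranspose_apply,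
      Fin.sum_univ_three]
    simp [ZU, Fin.castLE]
    simp only [← C_mul, haa]
    rw [C_mul]
    ring
  · rw [charpoly_submatrix_smul_mul_conjTranspose (by norm_num), Matrix.charpoly_two_by_two]
    have hfactor : ∀ p q : ℂ, p = t + lam → q = t * lam →
        X ^ (4 - 2) * (X ^ 2 - C p * X + C q) = X ^ 2 * (X - C (t : ℂ)) * (X - C (lam : ℂ)) := by
      rintro p q rfl rfl
      simp
      ring
    apply hfactor
    · simp only [Matrix.smul_apply, Matrix.mul_apply, Matrix.conjTranspose_apply,
        Fin.sum_univ_four]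
      simp [ZU, Fin.castLE]
      grind
    · simp only [Matrix.smul_apply, Matrix.mul_apply, Matrix.conjTranspose_apply,
        Fin.sum_univ_four]
      simp [ZU, Fin.castLE]
      grind

/-- The boundary fiber of the Gelfand–Cetlin system on `Gr(2,5)` over the point with all
pattern entries equal to `t` is `{λ·Z_U·Z_Uᴴ : U ∈ U(2)}`, and `U ↦ λ·Z_U·Z_Uᴴ` is
injective; thus this fiber is in bijection with `U(2)`. -/
theorem stmt18 (lam t : ℝ) (h0 : 0 < t) (h1 : t < lam) :
    ({x : Matrix (Fin 5) (Fin 5) ℂ | x.IsHermitian ∧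
        x.charpoly = X ^ 3 * (X - C (lam : ℂ)) ^ 2 ∧
        (x.submatrix (Fin.castLE (by norm_num)) (Fin.castLE (by norm_num)) :
            Matrix (Fin 2) (Fin 2) ℂ) = (t : ℂ) • 1 ∧
        (x.submatrix (Fin.castLE (by norm_num)) (Fin.castLE (by norm_num)) :
            Matrix (Fin 3) (Fin 3) ℂ).charpoly = X * (X - C (t : ℂ)) ^ 2 ∧
        (x.submatrix (Fin.castLE (by norm_num)) (Fin.castLE (by norm_num)) :
            Matrix (Fin 4) (Fin 4) ℂ).charpoly =
          X ^ 2 * (X - C (t : ℂ)) * (X - C (lam : ℂ))} =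
      {y : Matrix (Fin 5) (Fin 5) ℂ | ∃ U ∈ Matrix.unitaryGroup (Fin 2) ℂ,
        y = (lam : ℂ) • (ZU lam t U * (ZU lam t U)ᴴ)}) ∧
    (∀ U V : Matrix (Fin 2) (Fin 2) ℂ,
      U ∈ Matrix.unitaryGroup (Fin 2) ℂ → V ∈ Matrix.unitaryGroup (Fin 2) ℂ →
      (lam : ℂ) • (ZU lam t U * (ZU lam t U)ᴴ) =
        (lam : ℂ) • (ZU lam t V * (ZU lam t V)ᴴ) → U = V) := by
  refine ⟨Set.ext fun x => ⟨?_, ?_⟩, ?_⟩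
  · rintro ⟨hx, hc5, hc2, hc3, -⟩
    have h00 : x 0 0 = t := by simpa using congr_fun₂ hc2 0 0
    have h01 : x 0 1 = 0 := by simpa using congr_fun₂ hc2 0 1
    have h11 : x 1 1 = t := by simpa using congr_fun₂ hc2 1 1
    have htr := Matrix.trace_eq_neg_charpoly_coeff (x.submatrix
      (Fin.castLE (by norm_num : 3 ≤ 5)) (Fin.castLE (by norm_num)))
    have hp : (X * (X - C (t : ℂ)) ^ 2).coeff 2 = -2 * (t : ℂ) := by
      have : X * (X - C (t : ℂ)) ^ 2 = X ^ 3 - C (2 * (t : ℂ)) * X ^ 2 + C ((t : ℂ) ^ 2) * X := by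
        simp only [C_mul, C_pow, C_ofNat]
        ring
      rw [this]
      simp [coeff_X_pow, -map_mul, -map_pow]
    rw [hc3, Fintype.card_fin, hp, Matrix.trace_fin_three] at htr
    change x 0 0 + x 1 1 + x 2 2 = _ at htr
    have h22 : x 2 2 = 0 := by
      rw [h00, h11] at htr
      linear_combination htr
    exact exists_eq_smul_ZU_mul_conjTranspose h0 h1 hx (hx.sq_eq_smul_of_charpoly lam hc5)
      h00 h01 h11 h22
  · rintro ⟨U, hU, rfl⟩
    obtain ⟨h5, h3, h4⟩ := charpoly_smul_ZU_mul_conjTranspose h0 h1 hU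
    refine ⟨?_, h5, ?_, h3, h4⟩
    · simp [Matrix.IsHermitian, Matrix.conjTranspose_smul]
    · rw [smul_ZU_mul_conjTranspose h0 h1 hU]
      ext i j
      fin_cases i <;> fin_cases j <;> simp [Fin.castLE]
  · intro U V hU hV h
    rw [smul_ZU_mul_conjTranspose h0 h1 hU, smul_ZU_mul_conjTranspose h0 h1 hV] at h
    have hc0 : Real.sqrt (t * (lam - t)) ≠ 0 :=
      (Real.sqrt_pos.2 (mul_pos h0 (sub_pos.2 h1))).ne'
    have e00 := congr_fun₂ h 3 0
    have e01 := congr_fun₂ h 3 1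
    have e10 := congr_fun₂ h 4 0
    have e11 := congr_fun₂ h 4 1
    simp [hc0] at e00 e01 e10 e11
    ext i j
    fin_cases i <;> fin_cases j <;> assumption
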